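/- In a matching market in which all choice functions are path-independent and cardinal monotone, let μ, μ' be stable matchings such that μ' is an immediate predecessor of μ in (S, ⪰). Then μ(f) \ μ'(f) = P_f(μ) \ P_f(μ') for every firm f; in particular, P(μ) \ P(μ') = ρ⁺(μ', μ). -/

import Mathlib

/-- A matching market: finite disjoint sets of firms `F` and workers `W`; each firm `f`
has a set `accF f ⊆ W` of acceptable workers and a choice function `Cf f` on subsets of
`accF f`; each worker `w` has a set `accW w ⊆ F` and a choice function `Cw w`, where
`f ∈ accW w ↔ w ∈ accF f`. -/
structure Market (F W : Type*) [Fintype F] [Fintype W] [DecidableEq F] [DecidableEq W] where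
  accF : F → Finset W
  accW : W → Finset F
  compat : ∀ f w, f ∈ accW w ↔ w ∈ accF f
  Cf : F → Finset W → Finset W
  Cw : W → Finset F → Finset F
  CfSub : ∀ f S, Cf f S ⊆ S
  CwSub : ∀ w S, Cw w S ⊆ S

namespace Market

variable {F W : Type*} [Fintype F] [Fintype W] [DecidableEq F] [DecidableEq W]

/-- The set `μ(w)` of firms matched to worker `w` under the matching `μ`. -/
def mw (M : Market F W) (μ : F → Finset W) (w : W) : Finset F :=
  Finset.univ.filter (fun f => w ∈ μ f)

/-- `μ` is a matching: each firm is matched to acceptable workers. -/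
def IsMatching (M : Market F W) (μ : F → Finset W) : Prop :=
  ∀ f, μ f ⊆ M.accF f

/-- `μ` is individually rational. -/
def IndRational (M : Market F W) (μ : F → Finset W) : Prop :=
  (∀ f, M.Cf f (μ f) = μ f) ∧ (∀ w, M.Cw w (M.mw μ w) = M.mw μ w)

/-- The acceptable pair `(f, w)` blocks `μ`. -/
def Blocks (M : Market F W) (μ : F → Finset W) (f : F) (w : W) : Prop :=
  w ∈ M.accF f ∧ w ∉ μ f ∧
    w ∈ M.Cf f (insert w (μ f)) ∧ f ∈ M.Cw w (insert f (M.mw μ w))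

/-- `μ` is a stable matching. -/
def Stable (M : Market F W) (μ : F → Finset W) : Prop :=
  M.IsMatching μ ∧ M.IndRational μ ∧ ∀ f w, ¬ M.Blocks μ f w

/-- `Dom M μ2 μ1` is the partial order `μ2 ⪰ μ1` on stable matchings:
`C_f(μ2(f) ∪ μ1(f)) = μ2(f)` for every firm `f`. -/
def Dom (M : Market F W) (μ2 μ1 : F → Finset W) : Prop :=
  ∀ f, M.Cf f (μ2 f ∪ μ1 f) = μ2 f

/-- `φ(f)`: the set of stable partners of firm `f`. -/
def phi (M : Market F W) (f : F) : Set W :=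
  {w | ∃ μ, M.Stable μ ∧ w ∈ μ f}

/-- `P_f(μ) = {w ∈ φ(f) : w ∈ C_f(μ(f) ∪ {w})}`. -/
def Pf (M : Market F W) (μ : F → Finset W) (f : F) : Set W :=
  {w | w ∈ M.phi f ∧ w ∈ M.Cf f (insert w (μ f))}

/-- The P-set `P(μ) = {(f, w) : f ∈ F, w ∈ P_f(μ)}`. -/
def Pset (M : Market F W) (μ : F → Finset W) : Set (F × W) :=
  {p | p.2 ∈ M.Pf μ p.1}

/-- All choice functions of the market are path-independent and cardinal monotone
(on their domains). -/
def PathIndepCM (M : Market F W) : Prop :=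
  (∀ f, ∀ S ⊆ M.accF f, ∀ T ⊆ M.accF f, M.Cf f (S ∪ T) = M.Cf f (M.Cf f S ∪ T)) ∧
  (∀ f, ∀ S T : Finset W, S ⊆ T → T ⊆ M.accF f → (M.Cf f S).card ≤ (M.Cf f T).card) ∧
  (∀ w, ∀ S ⊆ M.accW w, ∀ T ⊆ M.accW w, M.Cw w (S ∪ T) = M.Cw w (M.Cw w S ∪ T)) ∧
  (∀ w, ∀ S T : Finset F, S ⊆ T → T ⊆ M.accW w → (M.Cw w S).card ≤ (M.Cw w T).card)

end Market

/-- `μ'` is an immediate predecessor of `μ` in `(S, ⪰)`: `μ' ≻ μ` and no stable `μ''`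
lies strictly between them. -/
def Market.ImmPred {F W : Type*} [Fintype F] [Fintype W] [DecidableEq F] [DecidableEq W]
    (M : Market F W) (μ' μ : F → Finset W) : Prop :=
  M.Dom μ' μ ∧ μ' ≠ μ ∧
    ¬ ∃ μ'' : F → Finset W, M.Stable μ'' ∧
        (M.Dom μ' μ'' ∧ μ' ≠ μ'') ∧ (M.Dom μ'' μ ∧ μ'' ≠ μ)

/-- Path-independence of the choice function `C` on subsets of `E`. -/
structure PathIndepOn {α : Type*} [DecidableEq α] (C : Finset α → Finset α) (E : Finset α) :
    Prop where
  sub : ∀ S, C S ⊆ S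
  pathIndep : ∀ S ⊆ E, ∀ T ⊆ E, C (S ∪ T) = C (C S ∪ T)

namespace PathIndepOn

variable {α : Type*} [DecidableEq α] {C : Finset α → Finset α} {E S T : Finset α} {x : α}

theorem idem (h : PathIndepOn C E) (hS : S ⊆ E) : C (C S) = C S := by
  simpa using (h.pathIndep S hS ∅ (by simp)).symm

theorem consistent (h : PathIndepOn C E) (hT : T ⊆ E) (hCS : C T ⊆ S) (hST : S ⊆ T) :
    C S = C T := by
  have := h.pathIndep T hT S (hST.trans hT)
  rwa [Finset.union_eq_left.2 hST, Finset.union_eq_right.2 hCS, eq_comm] at this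

theorem mem_of_subset (h : PathIndepOn C E) (hT : T ⊆ E) (hST : S ⊆ T) (hxS : x ∈ S)
    (hx : x ∈ C T) : x ∈ C S := by
  have := h.pathIndep S (hST.trans hT) (T \ S) (Finset.sdiff_subset.trans hT)
  rw [Finset.union_sdiff_of_subset hST] at this
  rw [this] at hx
  have := h.sub _ hx
  simp only [Finset.mem_union, Finset.mem_sdiff] at this
  tauto

theorem insert_choice (h : PathIndepOn C E) (hT : T ⊆ E) (hx : x ∈ E) :
    C (insert x (C T)) = C (insert x T) := by
  have := h.pathIndep T hT {x} (by simpa using hx)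
  rw [Finset.union_comm, Finset.union_comm (C T)] at this
  exact this.symm

/-- A fixed point `S` of `C` is still chosen when elements rejected one at a time are added. -/
theorem choice_eq_of_rejected (h : PathIndepOn C E) (hS : C S = S) (hT : T ⊆ E) (hST : S ⊆ T)
    (hrej : ∀ x ∈ T, x ∈ C (insert x S) → x ∈ S) : C T = S := by
  have hsub : C T ⊆ S := fun x hx =>
    hrej x (h.sub _ hx) (h.mem_of_subset hT (Finset.insert_subset (h.sub _ hx) hST) (by simp) hx)
  rw [← h.consistent hT hsub hST, hS]

end PathIndepOn

namespace Market

variable {F W : Type*} [Fintype F] [Fintype W] [DecidableEq F] [DecidableEq W]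
  {M : Market F W} {μ ν κ : F → Finset W} {f : F} {w : W}

theorem mem_mw : f ∈ M.mw μ w ↔ w ∈ μ f := by simp [mw]

theorem PathIndepCM.firm (h : M.PathIndepCM) (f : F) : PathIndepOn (M.Cf f) (M.accF f) :=
  ⟨M.CfSub f, h.1 f⟩

theorem PathIndepCM.worker (h : M.PathIndepCM) (w : W) : PathIndepOn (M.Cw w) (M.accW w) :=
  ⟨M.CwSub w, h.2.2.1 w⟩

/-- The market with the roles of firms and workers exchanged. -/
def swap (M : Market F W) : Market W F where
  accF := M.accW
  accW := M.accF
  compat w f := (M.compat f w).symm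
  Cf := M.Cw
  Cw := M.Cf
  CfSub := M.CwSub
  CwSub := M.CfSub

theorem PathIndepCM.swap (h : M.PathIndepCM) : M.swap.PathIndepCM :=
  ⟨h.2.2.1, h.2.2.2, h.1, h.2.1⟩

theorem swap_mw_mw (M : Market F W) (μ : F → Finset W) : M.swap.mw (M.mw μ) = μ := by
  ext f w
  rw [mem_mw, mem_mw]

theorem Stable.mw_subset (hμ : M.Stable μ) (w : W) : M.mw μ w ⊆ M.accW w := fun _ hf =>
  (M.compat _ _).2 (hμ.1 _ (mem_mw.1 hf))

theorem Stable.swap (hμ : M.Stable μ) : M.swap.Stable (M.mw μ) := by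
  refine ⟨hμ.mw_subset, ⟨hμ.2.1.2, fun f => ?_⟩, fun w f hb => ?_⟩
  · rw [swap_mw_mw]
    exact hμ.2.1.1 f
  · obtain ⟨h1, h2, h3, h4⟩ := hb
    rw [swap_mw_mw] at h4
    exact hμ.2.2 f w ⟨(M.compat f w).1 h1, fun hw => h2 (mem_mw.2 hw), h4, h3⟩

theorem Stable.of_swap {α : W → Finset F} (hα : M.swap.Stable α) :
    M.Stable (M.swap.mw α) := hα.swap

/-- The firms that `w` holds under `μ` or would reject if they were added to `μ(w)`. -/
def nonImproving (M : Market F W) (μ : F → Finset W) (w : W) : Finset F :=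
  (M.accW w).filter fun f => f ∈ M.Cw w (insert f (M.mw μ w)) → w ∈ μ f

theorem Stable.mw_subset_nonImproving (hμ : M.Stable μ) (w : W) :
    M.mw μ w ⊆ M.nonImproving μ w := fun _ hf =>
  Finset.mem_filter.2 ⟨hμ.mw_subset w hf, fun _ => mem_mw.1 hf⟩

theorem Stable.mem_nonImproving (hμ : M.Stable μ) (hw : w ∈ M.accF f)
    (hc : w ∈ M.Cf f (insert w (μ f))) : f ∈ M.nonImproving μ w := by
  refine Finset.mem_filter.2 ⟨(M.compat _ _).2 hw, fun hf => ?_⟩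
  by_contra hn
  exact hμ.2.2 f w ⟨hw, hn, hc, hf⟩

theorem Stable.choice_nonImproving (h : M.PathIndepCM) (hμ : M.Stable μ) (w : W) :
    M.Cw w (M.nonImproving μ w) = M.mw μ w :=
  (h.worker w).choice_eq_of_rejected (hμ.2.1.2 w) (Finset.filter_subset _ _)
    (hμ.mw_subset_nonImproving w) fun _ hf hc => mem_mw.2 ((Finset.mem_filter.1 hf).2 hc)

/-- The firm-wise join of two matchings. -/
def join (M : Market F W) (μ ν : F → Finset W) (f : F) : Finset W :=
  M.Cf f (μ f ∪ ν f)

theorem sum_card_mw (M : Market F W) (μ : F → Finset W) :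
    ∑ w, (M.mw μ w).card = ∑ f, (μ f).card := by
  have := Finset.sum_card_bipartiteAbove_eq_sum_card_bipartiteBelow
    (s := (Finset.univ : Finset F)) (t := (Finset.univ : Finset W)) (fun f w => w ∈ μ f)
  simp only [Finset.bipartiteAbove, Finset.bipartiteBelow, Finset.filter_univ_mem] at this
  exact this.symm

theorem Stable.union_subset (hμ : M.Stable μ) (hν : M.Stable ν) (f : F) :
    μ f ∪ ν f ⊆ M.accF f :=
  Finset.union_subset (hμ.1 f) (hν.1 f)

theorem Stable.mem_nonImproving_of_mem_choice (h : M.PathIndepCM) (hμ : M.Stable μ)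
    {S : Finset W} (hS : S ⊆ M.accF f) (hμS : μ f ⊆ S) (hw : w ∈ M.Cf f S) :
    f ∈ M.nonImproving μ w := by
  have hwS := M.CfSub f _ hw
  exact hμ.mem_nonImproving (hS hwS)
    ((h.firm f).mem_of_subset hS (Finset.insert_subset hwS hμS) (by simp) hw)

/-- The join assigns to `w` its choice from the firms not improving on either matching. -/
theorem mw_join (h : M.PathIndepCM) (hμ : M.Stable μ) (hν : M.Stable ν) (w : W) :
    M.mw (M.join μ ν) w = M.Cw w (M.nonImproving μ w ∩ M.nonImproving ν w) := by
  have hsub : ∀ w, M.mw (M.join μ ν) w ⊆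
      M.Cw w (M.nonImproving μ w ∩ M.nonImproving ν w) := by
    intro w f hf
    have hwJ : w ∈ M.Cf f (μ f ∪ ν f) := (mem_mw (μ := M.join μ ν)).1 hf
    have hacc := hμ.union_subset hν f
    have hD : f ∈ M.nonImproving μ w ∩ M.nonImproving ν w := Finset.mem_inter.2
      ⟨hμ.mem_nonImproving_of_mem_choice h hacc Finset.subset_union_left hwJ,
        hν.mem_nonImproving_of_mem_choice h hacc Finset.subset_union_right hwJ⟩
    rcases Finset.mem_union.1 (M.CfSub f _ hwJ) with hw | hw
    · refine (h.worker w).mem_of_subset (Finset.filter_subset _ _) Finset.inter_subset_left hD ?_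
      rw [← nonImproving, hμ.choice_nonImproving h]
      exact mem_mw.2 hw
    · refine (h.worker w).mem_of_subset (Finset.filter_subset _ _) Finset.inter_subset_right hD ?_
      rw [← nonImproving, hν.choice_nonImproving h]
      exact mem_mw.2 hw
  have hle : ∀ w, (M.Cw w (M.nonImproving μ w ∩ M.nonImproving ν w)).card ≤
      (M.mw μ w).card := by
    intro w
    rw [← hμ.choice_nonImproving h]
    exact h.2.2.2 w _ _ Finset.inter_subset_left (Finset.filter_subset _ _)
  have hge : ∑ w, (M.mw μ w).card ≤ ∑ w, (M.mw (M.join μ ν) w).card := by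
    rw [sum_card_mw, sum_card_mw]
    refine Finset.sum_le_sum fun f _ => ?_
    conv_lhs => rw [← hμ.2.1.1 f]
    exact h.2.1 f _ _ Finset.subset_union_left (hμ.union_subset hν f)
  have hcard : ∀ w ∈ Finset.univ, (M.mw (M.join μ ν) w).card = (M.mw μ w).card := by
    have hle' : ∀ w ∈ Finset.univ, (M.mw (M.join μ ν) w).card ≤ (M.mw μ w).card := fun w _ =>
      (Finset.card_le_card (hsub w)).trans (hle w)
    exact (Finset.sum_eq_sum_iff_of_le hle').1 (le_antisymm (Finset.sum_le_sum hle') hge)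
  exact Finset.eq_of_subset_of_card_le (hsub w) ((hle w).trans (hcard w (by simp)).ge)

theorem mem_join_of_nonImproving (h : M.PathIndepCM) (hμ : M.Stable μ) (hν : M.Stable ν)
    (hf : f ∈ M.nonImproving μ w) (hw : w ∈ ν f) : w ∈ M.join μ ν f := by
  rw [← mem_mw (M := M), mw_join h hμ hν]
  have hfν : f ∈ M.mw ν w := mem_mw.2 hw
  refine (h.worker w).mem_of_subset (Finset.filter_subset _ _) Finset.inter_subset_right
    (Finset.mem_inter.2 ⟨hf, hν.mw_subset_nonImproving w hfν⟩) ?_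
  rwa [← nonImproving, hν.choice_nonImproving h]

theorem Stable.join (h : M.PathIndepCM) (hμ : M.Stable μ) (hν : M.Stable ν) :
    M.Stable (M.join μ ν) := by
  have hacc := hμ.union_subset hν
  have hD : ∀ w, M.nonImproving μ w ∩ M.nonImproving ν w ⊆ M.accW w := fun w =>
    Finset.inter_subset_left.trans (Finset.filter_subset _ _)
  refine ⟨fun f => (M.CfSub f _).trans (hacc f), ⟨fun f => (h.firm f).idem (hacc f), fun w => ?_⟩,
    fun f w hb => ?_⟩
  · rw [mw_join h hμ hν, (h.worker w).idem (hD w)]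
  · obtain ⟨hw, hn, hcf, hcw⟩ := hb
    rw [Market.join, (h.firm f).insert_choice (hacc f) hw] at hcf
    have hins := Finset.insert_subset hw (hacc f)
    have hfD : f ∈ M.nonImproving μ w ∩ M.nonImproving ν w := Finset.mem_inter.2
      ⟨hμ.mem_nonImproving_of_mem_choice h hins
          (Finset.subset_union_left.trans (Finset.subset_insert _ _)) hcf,
        hν.mem_nonImproving_of_mem_choice h hins
          (Finset.subset_union_right.trans (Finset.subset_insert _ _)) hcf⟩
    rw [mw_join h hμ hν, (h.worker w).insert_choice (hD w) ((M.compat f w).2 hw),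
      Finset.insert_eq_of_mem hfD, ← mw_join h hμ hν] at hcw
    exact hn (mem_mw.1 hcw)

theorem dom_join_left (h : M.PathIndepCM) (hμ : M.Stable μ) (hν : M.Stable ν) :
    M.Dom (M.join μ ν) μ := fun f =>
  (h.firm f).consistent (hμ.union_subset hν f) Finset.subset_union_left
    (Finset.union_subset (M.CfSub f _) Finset.subset_union_left)

/-- An upper bound of two stable matchings dominates their join. -/
theorem Dom.join (h : M.PathIndepCM) (hμ : M.Stable μ) (hν : M.Stable ν) (hκ : M.Stable κ)
    (hκμ : M.Dom κ μ) (hκν : M.Dom κ ν) : M.Dom κ (M.join μ ν) := by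
  intro f
  have hall : M.Cf f (κ f ∪ μ f ∪ ν f) = κ f := by
    rw [(h.firm f).pathIndep _ (hκ.union_subset hμ f) _ (hν.1 f), hκμ f, hκν f]
  have := (h.firm f).consistent (S := κ f ∪ M.join μ ν f)
    (Finset.union_subset (hκ.union_subset hμ f) (hν.1 f))
    (by rw [hall]; exact Finset.subset_union_left)
    (by
      rw [Finset.union_assoc]
      exact Finset.union_subset_union_right (M.CfSub f _))
  rw [this, hall]

/-- Opposition of interests: workers rank stable matchings oppositely to firms. -/
theorem Dom.swap (h : M.PathIndepCM) (hμ : M.Stable μ) (hν : M.Stable ν) (hd : M.Dom μ ν) :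
    M.swap.Dom (M.mw ν) (M.mw μ) := by
  intro w
  refine (h.worker w).choice_eq_of_rejected (hν.2.1.2 w)
    (Finset.union_subset (hν.mw_subset w) (hμ.mw_subset w)) Finset.subset_union_left
    fun f hf hc => ?_
  rcases Finset.mem_union.1 hf with hf | hf
  · exact hf
  · have hwμ : w ∈ M.Cf f (μ f ∪ ν f) := by
      rw [hd f]
      exact mem_mw.1 hf
    have := hν.mem_nonImproving_of_mem_choice h (hμ.union_subset hν f)
      Finset.subset_union_right hwμ
    exact mem_mw.2 ((Finset.mem_filter.1 this).2 hc)

/-- A stable partner `w` that `f` wants at `μ` but not at a dominating `κ` is matched to `f`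
in some stable matching between `μ` and `κ`. -/
theorem exists_between (h : M.PathIndepCM) (hμ : M.Stable μ) (hκ : M.Stable κ)
    (hd : M.Dom κ μ) (hw : w ∈ M.Pf μ f) (hw' : w ∉ M.Cf f (insert w (κ f))) :
    ∃ ξ, M.Stable ξ ∧ M.Dom κ ξ ∧ M.Dom ξ μ ∧ w ∈ ξ f := by
  obtain ⟨⟨ν, hν, hwν⟩, hwc⟩ := hw
  have hacc := hν.1 f hwν
  have hJ := hμ.join h hν
  have hwJ : w ∈ M.join μ ν f :=
    mem_join_of_nonImproving h hμ hν (hμ.mem_nonImproving hacc hwc) hwν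
  have hs := h.swap
  have hα := hκ.swap.join hs hJ.swap
  refine ⟨_, hα.of_swap, ?_, ?_, ?_⟩
  · have := (dom_join_left hs hκ.swap hJ.swap).swap hs hα hκ.swap
    rwa [swap_mw_mw] at this
  · have := (Dom.join hs hκ.swap hJ.swap hμ.swap (hd.swap h hκ hμ)
      ((dom_join_left h hμ hν).swap h hJ hμ)).swap hs hμ.swap hα
    rwa [swap_mw_mw] at this
  · rw [mem_mw]
    refine mem_join_of_nonImproving hs hκ.swap hJ.swap (Finset.mem_filter.2 ⟨hacc, fun hc => ?_⟩)
      (mem_mw.2 hwJ)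
    rw [swap_mw_mw] at hc
    exact absurd hc hw'

theorem Stable.mem_Pf (hμ : M.Stable μ) (hw : w ∈ μ f) : w ∈ M.Pf μ f := by
  refine ⟨⟨μ, hμ, hw⟩, ?_⟩
  rwa [Finset.insert_eq_of_mem hw, hμ.2.1.1 f]

theorem coe_sdiff_eq_Pf_diff (h : M.PathIndepCM) (hμ : M.Stable μ) (hκ : M.Stable κ)
    (himm : M.ImmPred κ μ) (f : F) : (↑(μ f \ κ f) : Set W) = M.Pf μ f \ M.Pf κ f := by
  obtain ⟨hd, -, hbetween⟩ := himm
  ext w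
  simp only [Finset.mem_coe, Finset.mem_sdiff, Set.mem_sdiff]
  constructor
  · rintro ⟨hw, hw'⟩
    refine ⟨hμ.mem_Pf hw, fun hP => hw' ?_⟩
    have := (h.firm f).consistent (S := insert w (κ f)) (hκ.union_subset hμ f)
      (by rw [hd f]; exact Finset.subset_insert _ _)
      (Finset.insert_subset (Finset.mem_union_right _ hw) Finset.subset_union_left)
    rw [← hd f, ← this]
    exact hP.2
  · rintro ⟨hP, hP'⟩
    have hwκ : w ∉ κ f := fun hw => hP' (hκ.mem_Pf hw)
    refine ⟨?_, hwκ⟩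
    obtain ⟨ξ, hξ, hκξ, hξμ, hwξ⟩ := exists_between h hμ hκ hd hP fun hc => hP' ⟨hP.1, hc⟩
    by_contra hwμ
    refine hbetween ⟨ξ, hξ, ⟨hκξ, ?_⟩, hξμ, ?_⟩
    · rintro rfl
      exact hwκ hwξ
    · rintro rfl
      exact hwμ hwξ

end Market

/-- In a matching market in which all choice functions are
path-independent and cardinal monotone, if the stable matching `μ'` is an immediate
predecessor of the stable matching `μ` in `(S, ⪰)`, then
`μ(f) \ μ'(f) = P_f(μ) \ P_f(μ')` for every firm `f`; in particular,
`P(μ) \ P(μ') = ρ⁺(μ', μ)`. -/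
theorem stmt_15 {F W : Type*} [Fintype F] [Fintype W] [DecidableEq F] [DecidableEq W]
    (M : Market F W) (h : M.PathIndepCM)
    (μ μ' : F → Finset W) (hμ : M.Stable μ) (hμ' : M.Stable μ')
    (himm : M.ImmPred μ' μ) :
    (∀ f : F, (↑(μ f \ μ' f) : Set W) = M.Pf μ f \ M.Pf μ' f) ∧
    M.Pset μ \ M.Pset μ' = {p : F × W | p.2 ∈ μ p.1 \ μ' p.1} := by
  have hfirm := Market.coe_sdiff_eq_Pf_diff h hμ hμ' himm
  refine ⟨hfirm, ?_⟩
  ext ⟨f, w⟩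
  exact (Set.ext_iff.1 (hfirm f) w).symm
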